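/- Suppose N is odd, M is coprime to N, and each of A, B, C is coprime to MN. Then for every n ∈ ℤ/(MN)ℤ, the GDAFT of the pulsone localized at (k0, l0) has the closed form (F_a x^{(p)}_{(k0,l0)})[n] = (1/√(MN)) · e^{(2πi/(MN))(A n² + B n k0 + C k0²)} · ε_N · J(CM, N) · e^{−(2πi/N)·((4CM)⁻¹ mod N)·(B n + l0 + 2 C k0)²}, where ε_N = 1 if N ≡ 1 (mod 4) and ε_N = i if N ≡ 3 (mod 4), J(CM, N) is the Jacobi symbol of CM over N, and (4CM)⁻¹ mod N denotes the multiplicative inverse of 4CM modulo N. -/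

import Mathlib

open Finset

/-- e^{2πi t / Q} for an integer `t` and modulus `Q`. -/
noncomputable def eFrac (Q : ℕ) (t : ℤ) : ℂ :=
  Complex.exp (2 * Real.pi * Complex.I * (t : ℂ) / (Q : ℂ))

/-- Generalized discrete affine Fourier transform (GDAFT). -/
noncomputable def gdaft (M N : ℕ) (A B C : ℤ) (x : ZMod (M * N) → ℂ) :
    ZMod (M * N) → ℂ :=
  fun n => (Real.sqrt (M * N) : ℂ)⁻¹ *
    ∑ m ∈ Finset.range (M * N),
      eFrac (M * N) (A * (n.val : ℤ) ^ 2 + B * (n.val : ℤ) * (m : ℤ) + C * (m : ℤ) ^ 2) *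
        x (m : ZMod (M * N))

/-- Inverse GDAFT. -/
noncomputable def igdaft (M N : ℕ) (A B C : ℤ) (x : ZMod (M * N) → ℂ) :
    ZMod (M * N) → ℂ :=
  fun m => (Real.sqrt (M * N) : ℂ)⁻¹ *
    ∑ n ∈ Finset.range (M * N),
      eFrac (M * N) (-(A * (n : ℤ) ^ 2 + B * (n : ℤ) * (m.val : ℤ) + C * (m.val : ℤ) ^ 2)) *
        x (n : ZMod (M * N))

/-- The pulsone localized at `(k0, l0)`. -/
noncomputable def pulsone (M N : ℕ) (k0 l0 : ℕ) : ZMod (M * N) → ℂ :=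
  fun n => if n.val % M = k0 then
    (Real.sqrt N : ℂ)⁻¹ * eFrac N ((n.val / M : ℕ) * l0) else 0

/-- Cross-ambiguity function of two `MN`-periodic sequences. -/
noncomputable def amb (M N : ℕ) (y x : ZMod (M * N) → ℂ) (k l : ZMod (M * N)) : ℂ :=
  ((M * N : ℕ) : ℂ)⁻¹ * ∑ n ∈ Finset.range (M * N),
    y (n : ZMod (M * N)) * (starRingEnd ℂ) (x ((n : ZMod (M * N)) - k)) *
      eFrac (M * N) (-((l * ((n : ZMod (M * N)) - k)).val : ℤ))

/-- Delay-Doppler shift operator. -/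
noncomputable def ddShift (M N : ℕ) (k l : ZMod (M * N)) (x : ZMod (M * N) → ℂ) :
    ZMod (M * N) → ℂ :=
  fun n => x (n - k) * eFrac (M * N) ((l * (n - k)).val : ℤ)

/-- Inner product ⟨x, y⟩ = Σ x[n] conj(y[n]). -/
noncomputable def innerMN (M N : ℕ) (x y : ZMod (M * N) → ℂ) : ℂ :=
  ∑ n ∈ Finset.range (M * N),
    x (n : ZMod (M * N)) * (starRingEnd ℂ) (y (n : ZMod (M * N)))


lemma eFrac_add (Q : ℕ) (s t : ℤ) : eFrac Q (s + t) = eFrac Q s * eFrac Q t := by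
  rw [eFrac, eFrac, eFrac, ← Complex.exp_add]
  congr 1
  push_cast
  ring

lemma eFrac_eq_stdAddChar (Q : ℕ) [NeZero Q] (t : ℤ) :
    eFrac Q t = ZMod.stdAddChar (t : ZMod Q) := by
  rw [ZMod.stdAddChar_coe, eFrac]

lemma eFrac_mul_mul (Q R : ℕ) (hR : R ≠ 0) (t : ℤ) : eFrac (Q * R) (t * R) = eFrac Q t := by
  have : (R : ℂ) ≠ 0 := by exact_mod_cast hR
  rw [eFrac, eFrac]
  congr 1
  push_cast
  rw [← mul_assoc, mul_div_mul_right _ _ this]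

lemma eFrac_congr {Q : ℕ} (hQ : Q ≠ 0) {s t : ℤ} (h : s ≡ t [ZMOD (Q : ℤ)]) :
    eFrac Q s = eFrac Q t := by
  have : NeZero Q := ⟨hQ⟩
  rw [eFrac_eq_stdAddChar, eFrac_eq_stdAddChar, (ZMod.intCast_eq_intCast_iff s t Q).2 h]

/-- Split a sum over `range (M * N)` along residues modulo `M`. -/
lemma sum_range_mul_eq_sum_sum (M N : ℕ) (f : ℕ → ℂ) :
    ∑ m ∈ range (M * N), f m = ∑ k ∈ range M, ∑ d ∈ range N, f (k + d * M) := by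
  induction N with
  | zero => simp
  | succ N ih =>
    simp_rw [Finset.sum_range_succ _ N, Finset.sum_add_distrib, ← ih]
    rw [Nat.mul_succ, Finset.sum_range_add]
    simp [add_comm, mul_comm]

lemma sum_range_eq_sum_zmod (m : ℕ) [NeZero m] (g : ZMod m → ℂ) :
    ∑ k ∈ range m, g (k : ZMod m) = ∑ x : ZMod m, g x := by
  refine Finset.sum_nbij' (fun k => (k : ZMod m)) ZMod.val ?_ ?_ ?_ ?_ ?_
  · simp
  · intro x _
    exact mem_range.2 (ZMod.val_lt x)
  · intro k hk
    exact ZMod.val_cast_of_lt (mem_range.1 hk)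
  · simp
  · simp

/-- A complete sum of a periodic function is invariant under invertible affine substitutions. -/
lemma sum_range_affine {m : ℕ} (hm : m ≠ 0) {f : ℤ → ℂ}
    (hf : ∀ s t : ℤ, s ≡ t [ZMOD (m : ℤ)] → f s = f t) {u : ℤ} (hu : IsCoprime u (m : ℤ)) (c : ℤ) :
    ∑ k ∈ range m, f (u * k + c) = ∑ k ∈ range m, f k := by
  have : NeZero m := ⟨hm⟩
  let g : ZMod m → ℂ := fun x => f (x.val : ℤ)
  have hg : ∀ t : ℤ, f t = g (t : ZMod m) := by
    intro t
    apply hf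
    rw [← ZMod.intCast_eq_intCast_iff]
    simp
  simp_rw [hg]
  push_cast
  rw [sum_range_eq_sum_zmod m (fun x => g (u * x + c)), sum_range_eq_sum_zmod m g]
  have hu' : IsUnit (u : ZMod m) := by
    obtain ⟨a, b, h⟩ := hu
    refine IsUnit.of_mul_eq_one (a : ZMod m) ?_
    have := congrArg (Int.cast : ℤ → ZMod m) h
    push_cast at this
    simpa [mul_comm] using this
  obtain ⟨w, hw⟩ := hu'
  refine Fintype.sum_equiv ((Units.mulLeft w).trans (Equiv.addRight (c : ZMod m))) _ _ ?_
  intro x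
  simp [← hw]

/-- The quadratic Gauss sum `∑ e(a x² / N)`, `x` running over a complete residue system. -/
noncomputable def quadGauss (a : ℤ) (N : ℕ) : ℂ :=
  ∑ x ∈ range N, eFrac N (a * (x : ℤ) ^ 2)

lemma quadGauss_mul_of_coprime {m n : ℕ} (hm : m ≠ 0) (hn : n ≠ 0) (h : m.Coprime n) (a : ℤ) :
    quadGauss a (m * n) = quadGauss (a * n) m * quadGauss (a * m) n := by
  have hmn : m * n ≠ 0 := mul_ne_zero hm hn
  have hper : ∀ t s : ℤ, t ≡ s [ZMOD ((m * n : ℕ) : ℤ)] →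
      eFrac (m * n) (a * t ^ 2) = eFrac (m * n) (a * s ^ 2) :=
    fun t s hts => eFrac_congr hmn ((hts.pow 2).mul_left a)
  have hF : ∀ s t : ℤ, s ≡ t [ZMOD (m : ℤ)] →
      ∑ d ∈ range n, eFrac (m * n) (a * (s + d * m) ^ 2) =
      ∑ d ∈ range n, eFrac (m * n) (a * (t + d * m) ^ 2) := by
    intro s t hst
    obtain ⟨c, hc⟩ := hst.dvd
    rw [← sum_range_affine hn (f := fun d => eFrac (m * n) (a * (s + d * m) ^ 2)) ?_
      isCoprime_one_left c]
    · refine Finset.sum_congr rfl fun d _ => ?_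
      congr 3
      linear_combination -hc
    · intro d e hde
      apply hper
      push_cast
      rw [mul_comm (m : ℤ)]
      exact (hde.mul_right' ).add_left s
  have key := sum_range_affine hm hF (u := (n : ℤ)) (Nat.isCoprime_iff_coprime.2 h.symm) 0
  rw [quadGauss, sum_range_mul_eq_sum_sum]
  push_cast
  rw [← key, quadGauss, quadGauss, Finset.sum_mul_sum]
  refine Finset.sum_congr rfl fun y _ => Finset.sum_congr rfl fun z _ => ?_
  rw [← eFrac_mul_mul m n hn, ← eFrac_mul_mul n m hm, mul_comm n m, ← eFrac_add]
  refine eFrac_congr hmn (Int.modEq_iff_dvd.2 ⟨- (2 * a * y * z), ?_⟩)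
  push_cast
  ring

lemma sum_eFrac_linear {p : ℕ} (hp : p ≠ 0) (t : ℤ) :
    ∑ z ∈ range p, eFrac p (t * z) = if (p : ℤ) ∣ t then (p : ℂ) else 0 := by
  have : NeZero p := ⟨hp⟩
  simp_rw [eFrac_eq_stdAddChar]
  push_cast
  rw [sum_range_eq_sum_zmod p (fun x => ZMod.stdAddChar ((t : ZMod p) * x))]
  have := AddChar.sum_mulShift (t : ZMod p) (ZMod.isPrimitive_stdAddChar p)
  simp_rw [mul_comm (t : ZMod p), this, ZMod.card, ZMod.intCast_zmod_eq_zero_iff_dvd]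
  simp

lemma quadGauss_sq_mul {p n : ℕ} (hp : p.Prime) (hp2 : p ≠ 2) (hn : n ≠ 0) {a : ℤ}
    (ha : IsCoprime a (p : ℤ)) : quadGauss a (p * n * p) = p * quadGauss a n := by
  have hp0 : p ≠ 0 := hp.ne_zero
  have hdvd : ∀ y : ℕ, (p : ℤ) ∣ 2 * a * y ↔ y % p = 0 := by
    intro y
    have hpp : Prime (p : ℤ) := Nat.prime_iff_prime_int.1 hp
    rw [← Nat.dvd_iff_mod_eq_zero]
    constructor
    · intro h
      rcases hpp.dvd_or_dvd h with h | h
      · rcases hpp.dvd_or_dvd h with h | h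
        · exact absurd ((Nat.prime_dvd_prime_iff_eq hp Nat.prime_two).1 (by exact_mod_cast h)) hp2
        · exact absurd (ha.isUnit_of_dvd' h dvd_rfl) hpp.not_isUnit
      · exact_mod_cast h
    · intro h
      exact Dvd.dvd.mul_left (by exact_mod_cast h) _
  rw [quadGauss, sum_range_mul_eq_sum_sum]
  have h1 : ∀ y ∈ range (p * n), ∑ d ∈ range p,
      eFrac (p * n * p) (a * ((y + d * (p * n) : ℕ) : ℤ) ^ 2) =
      if y % p = 0 then p * eFrac (p * n * p) (a * (y : ℤ) ^ 2) else 0 := by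
    intro y _
    have : ∀ d ∈ range p, eFrac (p * n * p) (a * ((y + d * (p * n) : ℕ) : ℤ) ^ 2) =
        eFrac (p * n * p) (a * (y : ℤ) ^ 2) * eFrac p (2 * a * y * d) := by
      intro d _
      rw [← eFrac_mul_mul p (p * n) (mul_ne_zero hp0 hn), mul_comm p (p * n), ← eFrac_add]
      refine eFrac_congr (by positivity) (Int.modEq_iff_dvd.2 ⟨- (a * d ^ 2 * n), ?_⟩)
      push_cast
      ring
    rw [Finset.sum_congr rfl this, ← Finset.mul_sum, sum_eFrac_linear hp0]
    simp only [hdvd]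
    split_ifs <;> ring
  rw [Finset.sum_congr rfl h1, sum_range_mul_eq_sum_sum, Finset.sum_eq_single 0]
  · rw [quadGauss, Finset.mul_sum]
    refine Finset.sum_congr rfl fun d _ => ?_
    rw [if_pos (by simp), ← eFrac_mul_mul n (p * p) (mul_ne_zero hp0 hp0)]
    congr 2
    · ring
    · push_cast
      ring
  · intro k hk hk0
    refine Finset.sum_eq_zero fun d _ => if_neg ?_
    rw [Nat.add_mul_mod_self_right, Nat.mod_eq_of_lt (mem_range.1 hk)]
    exact hk0
  · intro h
    exact absurd (mem_range.2 hp.pos) h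

lemma quadGauss_prime {p : ℕ} (hp : p.Prime) (hp2 : p ≠ 2) {a : ℤ} (ha : IsCoprime a (p : ℤ)) :
    quadGauss a p = jacobiSym a p * quadGauss 1 p := by
  have : Fact p.Prime := ⟨hp⟩
  have hchar : ringChar (ZMod p) ≠ 2 := by rwa [ZMod.ringChar_zmod_n]
  let χ : MulChar (ZMod p) ℂ := (quadraticChar (ZMod p)).ringHomComp (Int.castRingHom ℂ)
  have key : ∀ b : ℤ, IsCoprime b (p : ℤ) →
      quadGauss b p = gaussSum χ (ZMod.stdAddChar.mulShift (b : ZMod p)) := by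
    intro b hb
    have hb0 : (b : ZMod p) ≠ 0 := by
      rw [Ne, ZMod.intCast_zmod_eq_zero_iff_dvd]
      intro h
      exact (Nat.prime_iff_prime_int.1 hp).not_isUnit (hb.isUnit_of_dvd' h dvd_rfl)
    simp_rw [quadGauss, eFrac_eq_stdAddChar]
    push_cast
    rw [sum_range_eq_sum_zmod p (fun x => ZMod.stdAddChar ((b : ZMod p) * x ^ 2)),
      ← Finset.sum_fiberwise' univ (fun x : ZMod p => x ^ 2)
        (fun t => ZMod.stdAddChar ((b : ZMod p) * t))]
    have hcard : ∀ t : ZMod p, ∑ _x ∈ univ.filter (fun x : ZMod p => x ^ 2 = t),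
        (ZMod.stdAddChar ((b : ZMod p) * t) : ℂ) =
        χ t * ZMod.stdAddChar.mulShift (b : ZMod p) t + ZMod.stdAddChar (t * (b : ZMod p)) := by
      intro t
      have h := quadraticChar_card_sqrts hchar t
      rw [Set.toFinset_ofPred] at h
      have h' := congrArg (Int.cast : ℤ → ℂ) h
      push_cast at h'
      rw [Finset.sum_const, nsmul_eq_mul, h', AddChar.mulShift_apply, mul_comm t]
      simp only [χ, MulChar.ringHomComp_apply, eq_intCast]
      ring
    rw [Finset.sum_congr rfl fun t _ => hcard t, Finset.sum_add_distrib,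
      AddChar.sum_mulShift _ (ZMod.isPrimitive_stdAddChar p), if_neg hb0]
    simp [gaussSum]
  obtain ⟨w, hw⟩ : IsUnit (a : ZMod p) := by
    rw [isUnit_iff_ne_zero, Ne, ZMod.intCast_zmod_eq_zero_iff_dvd]
    intro h
    exact (Nat.prime_iff_prime_int.1 hp).not_isUnit (ha.isUnit_of_dvd' h dvd_rfl)
  have hχ : (jacobiSym a p : ℂ) = χ a := by
    rw [← jacobiSym.legendreSym.to_jacobiSym]
    simp [χ, legendreSym]
  have hsq : χ a * χ a = 1 := by
    have h0 : (a : ZMod p) ≠ 0 := hw ▸ w.ne_zero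
    have := quadraticChar_sq_one h0
    simp only [χ, MulChar.ringHomComp_apply, eq_intCast]
    rw [← sq]
    exact_mod_cast this
  rw [key a ha, key 1 isCoprime_one_left, hχ]
  have hm := gaussSum_mulShift χ ZMod.stdAddChar w
  rw [hw] at hm
  rw [Int.cast_one, AddChar.mulShift_one, ← hm, ← mul_assoc, hsq, one_mul]

lemma quadGauss_eq_jacobiSym_mul (N : ℕ) (hN : Odd N) :
    ∀ a : ℤ, IsCoprime a (N : ℤ) → quadGauss a N = jacobiSym a N * quadGauss 1 N := by
  induction N using Nat.strong_induction_on with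
  | _ N ih =>
    intro a ha
    rcases eq_or_ne N 1 with rfl | hN1
    · simp [quadGauss, eFrac]
    obtain ⟨p, hp, n, rfl⟩ := Nat.exists_prime_and_dvd hN1
    have hpodd : Odd p := (Nat.odd_mul.1 hN).1
    have hnodd : Odd n := (Nat.odd_mul.1 hN).2
    have hp2 : p ≠ 2 := by
      rintro rfl
      exact absurd hpodd (by decide)
    have : NeZero p := ⟨hp.ne_zero⟩
    have hn0 : n ≠ 0 := hnodd.pos.ne'
    have : NeZero n := ⟨hn0⟩
    push_cast at ha
    have hap : IsCoprime a (p : ℤ) := ha.of_mul_right_left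
    have han : IsCoprime a (n : ℤ) := ha.of_mul_right_right
    have hlt : n < p * n := by nlinarith [hp.two_le, hnodd.pos]
    by_cases hpn : p ∣ n
    · obtain ⟨k, rfl⟩ := hpn
      have hk0 : k ≠ 0 := right_ne_zero_of_mul hn0
      have : NeZero k := ⟨hk0⟩
      have hak : IsCoprime a (k : ℤ) := by
        push_cast at han
        exact han.of_mul_right_right
      have hsq : (jacobiSym a p : ℂ) * jacobiSym a p = 1 := by
        rw [← sq]
        exact_mod_cast jacobiSym.sq_one (Int.isCoprime_iff_gcd_eq_one.1 hap)
      rw [mul_comm p (p * k), quadGauss_sq_mul hp hp2 hk0 hap,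
        quadGauss_sq_mul hp hp2 hk0 isCoprime_one_left,
        ih k (by nlinarith [hp.two_le, Nat.pos_of_ne_zero hk0]) (Nat.odd_mul.1 hnodd).2 a hak,
        jacobiSym.mul_right, jacobiSym.mul_right]
      push_cast
      linear_combination (-(jacobiSym a k : ℂ) * p * quadGauss 1 k) * hsq
    · have hcop : p.Coprime n := (Nat.Prime.coprime_iff_not_dvd hp).2 hpn
      have hpn' : IsCoprime (p : ℤ) (n : ℤ) := Nat.isCoprime_iff_coprime.2 hcop
      rw [quadGauss_mul_of_coprime hp.ne_zero hn0 hcop,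
        quadGauss_mul_of_coprime hp.ne_zero hn0 hcop, one_mul, one_mul,
        quadGauss_prime hp hp2 (hap.mul_left hpn'.symm), quadGauss_prime hp hp2 hpn'.symm,
        ih n hlt hnodd _ (han.mul_left hpn'), ih n hlt hnodd _ hpn',
        jacobiSym.mul_left, jacobiSym.mul_left, jacobiSym.mul_right]
      push_cast
      ring

open Complex in
lemma summable_exp_pi_mul_sq {τ : ℂ} (hτ : 0 < τ.im) :
    Summable fun n : ℤ => cexp (Real.pi * I * n ^ 2 * τ) := by
  simpa [jacobiTheta₂_term] using (summable_jacobiTheta₂_term_iff 0 τ).2 hτ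

open Filter Topology Complex in
/-- A twisted theta series tends to its constant term. -/
lemma tendsto_tsum_theta {ι : Type*} {l : Filter ι} {a : ι → ℂ}
    (ha : Tendsto (fun i => (a i).re) l atTop) (x : ℝ) :
    Tendsto (fun i => ∑' n : ℤ, cexp (-Real.pi * a i * n ^ 2 + 2 * Real.pi * (-I * x) * n))
      l (𝓝 1) := by
  have hnorm : ∀ (z : ℂ) (n : ℤ),
      ‖cexp (-Real.pi * z * n ^ 2 + 2 * Real.pi * (-I * x) * n)‖ =
        Real.exp (-Real.pi * z.re * n ^ 2) := by
    intro z n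
    rw [norm_exp]
    congr 1
    have : (-Real.pi * z * n ^ 2 + 2 * Real.pi * (-I * x) * n : ℂ) =
        ((-Real.pi * n ^ 2 : ℝ) : ℂ) * z + ((-2 * Real.pi * x * n : ℝ) : ℂ) * I := by
      push_cast
      ring
    rw [this, add_re, re_ofReal_mul, re_ofReal_mul, I_re]
    ring
  have hsum : Summable fun n : ℤ => Real.exp (-Real.pi * 1 * (n : ℝ) ^ 2) := by
    have h := (summable_exp_pi_mul_sq (τ := I) (by simp)).norm
    refine h.congr fun n => ?_
    rw [norm_exp]
    congr 1
    have : (Real.pi * I * n ^ 2 * I : ℂ) = ((-Real.pi * 1 * (n : ℝ) ^ 2 : ℝ) : ℂ) := by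
      push_cast
      linear_combination (Real.pi * n ^ 2 : ℂ) * I_mul_I
    rw [this, ofReal_re]
  have hlim : ∑' n : ℤ, (if n = 0 then (1 : ℂ) else 0) = 1 := by simp
  rw [← hlim]
  refine tendsto_tsum_of_dominated_convergence hsum (fun n => ?_) ?_
  · split_ifs with hn
    · simpa [hn] using tendsto_const_nhds
    · rw [tendsto_zero_iff_norm_tendsto_zero]
      simp_rw [hnorm]
      refine Real.tendsto_exp_atBot.comp ?_
      have hn2 : (0 : ℝ) < Real.pi * (n : ℝ) ^ 2 := by
        have : (n : ℝ) ≠ 0 := by exact_mod_cast hn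
        positivity
      have := tendsto_neg_atTop_atBot.comp (ha.const_mul_atTop hn2)
      refine this.congr fun i => ?_
      simp only [Function.comp]
      ring
  · filter_upwards [ha.eventually_ge_atTop 1] with i hi n
    rw [hnorm]
    apply Real.exp_le_exp.2
    have : 0 ≤ Real.pi * (n : ℝ) ^ 2 := by positivity
    nlinarith

open Filter Topology Complex in
/-- The leading asymptotics of a theta series with periodic coefficients. -/
lemma tendsto_tsum_periodic_theta {ι : Type*} {l : Filter ι} {a : ι → ℂ}
    (ha : Tendsto (fun i => (a i).re) l atTop) {q : ℕ} (hq : q ≠ 0) {c : ℤ → ℂ}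
    (hc : ∀ n, ‖c n‖ ≤ 1) (hper : ∀ m r : ℤ, c (m * q + r) = c r) :
    Tendsto (fun i => (∑' n : ℤ, c n * cexp (-Real.pi / a i * (n / q : ℂ) ^ 2)) /
      a i ^ (1 / 2 : ℂ)) l (𝓝 (∑ r ∈ range q, c r)) := by
  have : NeZero q := ⟨hq⟩
  have hqC : (q : ℂ) ≠ 0 := by exact_mod_cast hq
  have hsplit : ∀ z : ℂ, 0 < z.re →
      (∑' n : ℤ, c n * cexp (-Real.pi / z * (n / q : ℂ) ^ 2)) / z ^ (1 / 2 : ℂ) =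
      ∑ r : Fin q, c (r : ℕ) * ∑' n : ℤ,
        cexp (-Real.pi * z * n ^ 2 + 2 * Real.pi * (-I * ((r : ℕ) / q : ℝ)) * n) := by
    intro z hz
    have hz0 : z ≠ 0 := by
      rintro rfl
      simp at hz
    have hzpow : z ^ (1 / 2 : ℂ) ≠ 0 := by simp [cpow_eq_zero_iff, hz0]
    have hs : Summable fun n : ℤ => c n * cexp (-Real.pi / z * (n / q : ℂ) ^ 2) := by
      have hτ : 0 < (I / (z * q ^ 2)).im := by
        have : I / (z * q ^ 2) = ((((q : ℝ) ^ 2)⁻¹ : ℝ) : ℂ) * (z⁻¹ * I) := by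
          push_cast
          field_simp
        rw [this, im_ofReal_mul, mul_I_im, inv_re]
        have := normSq_pos.2 hz0
        positivity
      refine Summable.of_norm_bounded (summable_exp_pi_mul_sq hτ).norm fun n => ?_
      rw [norm_mul]
      have : (-Real.pi / z * (n / q : ℂ) ^ 2) = Real.pi * I * n ^ 2 * (I / (z * q ^ 2)) := by
        field_simp
        linear_combination (-n ^ 2 : ℂ) * I_sq
      rw [this]
      exact mul_le_of_le_one_left (norm_nonneg _) (hc n)
    let e : Fin q × ℤ ≃ ℤ := (Equiv.prodComm _ _).trans (Int.divModEquiv q).symm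
    have hs' := Summable.tsum_prod (e.summable_iff.2 hs)
    simp only [Function.comp_def] at hs'
    rw [← e.tsum_eq, hs', tsum_fintype, Finset.sum_div]
    refine Finset.sum_congr rfl fun r _ => ?_
    have he : ∀ n : ℤ, e (r, n) = n * q + (r : ℕ) := fun n => by
      simp [e, Int.divModEquiv]
    simp_rw [he, hper]
    rw [tsum_mul_left, tsum_exp_neg_quadratic hz, mul_div_assoc]
    congr 1
    rw [one_div_mul_eq_div]
    congr 1
    refine tsum_congr fun n => ?_
    congr 3
    push_cast
    field_simp
    linear_combination ((r : ℕ) : ℂ) * I_sq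
  have hlim : Tendsto (fun i => ∑ r : Fin q, c (r : ℕ) * ∑' n : ℤ,
      cexp (-Real.pi * a i * n ^ 2 + 2 * Real.pi * (-I * ((r : ℕ) / q : ℝ)) * n)) l
      (𝓝 (∑ r : Fin q, c (r : ℕ) * 1)) :=
    tendsto_finsetSum _ fun r _ => (tendsto_tsum_theta ha _).const_mul _
  rw [← Fin.sum_univ_eq_sum_range (fun r => c r)]
  simp only [mul_one] at hlim
  refine hlim.congr' ?_
  filter_upwards [ha.eventually_gt_atTop 0] with i hi
  rw [hsplit _ hi]

open Filter Topology Complex in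
lemma tendsto_cpow_add_const_div (z : ℂ) :
    Tendsto (fun s : ℝ => ((s : ℂ) + z) ^ (1 / 2 : ℂ) / (s : ℂ) ^ (1 / 2 : ℂ)) atTop (𝓝 1) := by
  have h1 : Tendsto (fun s : ℝ => 1 + ((s⁻¹ : ℝ) : ℂ) * z) atTop (𝓝 (1 + ((0 : ℝ) : ℂ) * z)) :=
    (((continuous_ofReal.tendsto 0).comp tendsto_inv_atTop_zero).mul_const z).const_add 1
  have h2 := (continuousAt_cpow_const (b := (1 / 2 : ℂ)) (a := 1) (by simp)).tendsto
  rw [ofReal_zero, zero_mul, add_zero] at h1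
  have h3 := h2.comp h1
  rw [one_cpow] at h3
  refine h3.congr' ?_
  filter_upwards [eventually_gt_atTop 0] with s hs
  have hsC : (s : ℂ) ≠ 0 := by exact_mod_cast hs.ne'
  have hspow : (s : ℂ) ^ (1 / 2 : ℂ) ≠ 0 := by simp [cpow_eq_zero_iff, hsC]
  rw [eq_div_iff hspow]
  have : (s : ℂ) + z = (1 + ((s⁻¹ : ℝ) : ℂ) * z) * (s : ℂ) := by
    push_cast
    field_simp
  rw [this]
  rcases eq_or_ne (1 + ((s⁻¹ : ℝ) : ℂ) * z) 0 with h0 | h0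
  · simp only [Function.comp, h0]
    simp
  · rw [Function.comp, cpow_def_of_ne_zero h0, cpow_def_of_ne_zero hsC,
      cpow_def_of_ne_zero (mul_ne_zero h0 hsC), mul_comm _ (s : ℂ), log_ofReal_mul hs h0,
      ← Complex.exp_add, ofReal_log hs.le]
    congr 1
    ring

open Filter Topology Complex in
/-- The quadratic Gauss sum in terms of its reciprocal sum of length two. -/
lemma quadGauss_one_eq_div (N : ℕ) (hN : N ≠ 0) :
    quadGauss 1 N = (1 + cexp (-(Real.pi * I * N / 2))) / (-(2 * I / N)) ^ (1 / 2 : ℂ) := by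
  have hNC : (N : ℂ) ≠ 0 := by exact_mod_cast hN
  have hNpos : (0 : ℝ) < N := by exact_mod_cast Nat.pos_of_ne_zero hN
  let u : ℝ → ℂ := fun s => ((((N : ℝ) ^ 2)⁻¹ * s⁻¹ : ℝ) : ℂ) + -(2 * I / N)
  have hleft := tendsto_tsum_periodic_theta (l := atTop) (a := fun s : ℝ => (s : ℂ))
    tendsto_id hN (c := fun n => eFrac N (1 * n ^ 2))
    (fun n => by
      rw [eFrac, show (2 * Real.pi * I * ((1 * n ^ 2 : ℤ) : ℂ) / N : ℂ) =
        ((2 * Real.pi * n ^ 2 / N : ℝ) : ℂ) * I by push_cast; ring, norm_exp_ofReal_mul_I])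
    (fun m r => eFrac_congr hN (Int.modEq_iff_dvd.2 ⟨-(m * (m * N + 2 * r)), by ring⟩))
  have hright := tendsto_tsum_periodic_theta (l := atTop)
    (a := fun s : ℝ => (s : ℂ) + I / (2 * N))
    (by
      refine tendsto_id.congr fun s => ?_
      rw [show I / (2 * N) = (((2 * (N : ℝ))⁻¹ : ℝ) : ℂ) * I by push_cast; ring]
      simp) two_ne_zero (c := fun n => cexp (-(Real.pi * I * N * n ^ 2 / 2)))
    (fun n => by
      rw [show (-(Real.pi * I * N * n ^ 2 / 2) : ℂ) =
        ((-(Real.pi * N * n ^ 2 / 2) : ℝ) : ℂ) * I by push_cast; ring, norm_exp_ofReal_mul_I])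
    (fun m r => by
      rw [exp_eq_exp_iff_exists_int]
      refine ⟨-(N * (m ^ 2 + m * r)), ?_⟩
      push_cast
      ring)
  have hu : Tendsto (fun s => u s ^ (1 / 2 : ℂ)) atTop (𝓝 ((-(2 * I / N)) ^ (1 / 2 : ℂ))) := by
    have h1 : Tendsto u atTop (𝓝 (((((N : ℝ) ^ 2)⁻¹ * 0 : ℝ) : ℂ) + -(2 * I / N))) :=
      ((continuous_ofReal.tendsto _).comp
        (tendsto_inv_atTop_zero.const_mul (((N : ℝ) ^ 2)⁻¹))).add_const _
    rw [mul_zero, ofReal_zero, zero_add] at h1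
    refine (continuousAt_cpow_const ?_).tendsto.comp h1
    refine mem_slitPlane_iff.2 (Or.inr ?_)
    rw [show -(2 * I / N) = ((-(2 / N : ℝ) : ℝ) : ℂ) * I by push_cast; ring]
    simp [hN]
  have hne : (-(2 * I / N) : ℂ) ^ (1 / 2 : ℂ) ≠ 0 := by
    simp [cpow_eq_zero_iff, hN]
  have hlim := (hright.mul (tendsto_cpow_add_const_div (I / (2 * N)))).div hu hne
  have hfun := tendsto_nhds_unique hleft (hlim.congr' ?_)
  · rw [quadGauss, hfun]
    simp [Finset.sum_range_succ]
  · filter_upwards [eventually_gt_atTop 0] with s hs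
    have hsC : (s : ℂ) ≠ 0 := by exact_mod_cast hs.ne'
    have hspow : (s : ℂ) ^ (1 / 2 : ℂ) ≠ 0 := by simp [cpow_eq_zero_iff, hsC]
    have hs2 : (s : ℂ) + I / (2 * N) ≠ 0 := by
      intro h
      have := congrArg re h
      rw [show I / (2 * N) = (((2 * (N : ℝ))⁻¹ : ℝ) : ℂ) * I by push_cast; ring] at this
      simp at this
      exact hs.ne' this
    have hs2pow : ((s : ℂ) + I / (2 * N)) ^ (1 / 2 : ℂ) ≠ 0 := by simp [cpow_eq_zero_iff, hs2]
    have hure : 0 < (u s).re := by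
      have : u s = ((((N : ℝ) ^ 2)⁻¹ * s⁻¹ : ℝ) : ℂ) + ((-(2 / N : ℝ) : ℝ) : ℂ) * I := by
        simp only [u]
        push_cast
        ring
      rw [this, add_re, ofReal_re, re_ofReal_mul, I_re, mul_zero, add_zero]
      positivity
    have hu0 : u s ≠ 0 := by
      intro h
      simp [h] at hure
    have hupow : u s ^ (1 / 2 : ℂ) ≠ 0 := by simp [cpow_eq_zero_iff, hu0]
    have hu' : u s * (N ^ 2 * s) = 1 - 2 * I * N * s := by
      simp only [u]
      push_cast
      field_simp
      ring
    have hinv : 1 / u s = I * N / 2 + 1 / (4 * ((s : ℂ) + I / (2 * N))) := by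
      have hs3 : (2 * N * s + I : ℂ) ≠ 0 := by
        intro h
        apply hs2
        field_simp
        linear_combination h
      have h4 : (4 * ((s : ℂ) + I / (2 * N))) = 2 * (2 * N * s + I) / N := by
        field_simp
        ring
      rw [h4, div_eq_iff hu0]
      have hNs : (N ^ 2 * s : ℂ) ≠ 0 := mul_ne_zero (pow_ne_zero 2 hNC) hsC
      apply mul_right_cancel₀ hNs
      rw [mul_assoc, hu']
      have h5 : (1 - 2 * I * N * s : ℂ) = -I * (2 * N * s + I) := by
        linear_combination I_sq
      rw [h5]
      obtain ⟨D, hD⟩ : ∃ D : ℂ, D = 2 * N * s + I := ⟨_, rfl⟩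
      rw [← hD] at hs3 ⊢
      field_simp
      linear_combination D * I_sq - hD
    have hL : ∑' n : ℤ, eFrac N (1 * n ^ 2) * cexp (-Real.pi / s * (n / N : ℂ) ^ 2) =
        ∑' n : ℤ, cexp (-Real.pi * u s * n ^ 2) := by
      refine tsum_congr fun n => ?_
      rw [eFrac, ← Complex.exp_add]
      congr 1
      simp only [u]
      push_cast
      field_simp
      ring
    have hR : ∑' n : ℤ, cexp (-(Real.pi * I * N * n ^ 2 / 2)) *
        cexp (-Real.pi / ((s : ℂ) + I / (2 * N)) * (n / (2 : ℕ) : ℂ) ^ 2) =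
        ∑' n : ℤ, cexp (-Real.pi / u s * n ^ 2) := by
      refine tsum_congr fun n => ?_
      rw [← Complex.exp_add, div_eq_mul_one_div (-Real.pi : ℂ) (u s), hinv]
      congr 1
      push_cast
      field_simp
      ring
    simp only [Pi.div_apply]
    rw [hL, hR, tsum_exp_neg_mul_int_sq hure]
    generalize ((s : ℂ) + I / (2 * N)) ^ (1 / 2 : ℂ) = X at *
    field_simp

open Complex in
/-- Gauss's evaluation of the quadratic Gauss sum of odd length. -/
lemma quadGauss_one (N : ℕ) (hN : Odd N) :
    quadGauss 1 N = (if N % 4 = 1 then 1 else I) * (Real.sqrt N : ℂ) := by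
  have hNpos : (0 : ℝ) < N := by exact_mod_cast hN.pos
  have hsq : (Real.sqrt N : ℂ) ^ 2 = N := by
    rw [← ofReal_pow, Real.sq_sqrt hNpos.le, ofReal_natCast]
  have hs0 : (Real.sqrt N : ℂ) ≠ 0 := by
    exact_mod_cast (Real.sqrt_pos.2 hNpos).ne'
  have hroot : (-(2 * I / N)) ^ (1 / 2 : ℂ) = (1 - I) / (Real.sqrt N : ℂ) := by
    have h1 : (-(2 * I / N) : ℂ) = ((1 - I) / (Real.sqrt N : ℂ)) ^ 2 := by
      rw [div_pow, hsq, sub_sq, I_sq]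
      ring
    rw [h1, one_div, sq_cpow_two_inv]
    rw [div_ofReal_re]
    simpa using hN.pos
  have h1I : (1 - I : ℂ) ≠ 0 := by
    intro h
    simpa using congrArg re h
  rw [quadGauss_one_eq_div N hN.pos.ne', hroot]
  have hexp : cexp (-(Real.pi * I * N / 2)) = (-I) ^ N := by
    rw [← exp_neg_pi_div_two_mul_I, ← Complex.exp_nat_mul]
    congr 1
    ring
  rw [hexp, div_div_eq_mul_div, div_eq_iff h1I]
  obtain ⟨k, hk⟩ | ⟨k, hk⟩ : (∃ k, N = 4 * k + 1) ∨ ∃ k, N = 4 * k + 3 := by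
    obtain ⟨j, hj⟩ := hN
    rcases Nat.even_or_odd' j with ⟨k, rfl | rfl⟩
    · exact Or.inl ⟨k, by omega⟩
    · exact Or.inr ⟨k, by omega⟩
  all_goals
    have h4 : (-I) ^ 4 = 1 := by rw [neg_pow, I_pow_four]; norm_num
    have hpow : (-I) ^ N = if N % 4 = 1 then -I else I := by
      rw [hk, pow_add, pow_mul, h4, one_pow, one_mul]
      split_ifs <;> first | omega | simp [pow_succ]
    rw [hpow]
    split_ifs
    · ring
    · linear_combination (Real.sqrt N : ℂ) * I_sq

/-- Evaluation of the quadratic Gauss sum of odd length and arbitrary invertible coefficient. -/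
lemma quadGauss_eq (N : ℕ) (hN : Odd N) (a : ℤ) (ha : IsCoprime a (N : ℤ)) :
    quadGauss a N =
      (if N % 4 = 1 then 1 else Complex.I) * (jacobiSym a N : ℂ) * (Real.sqrt N : ℂ) := by
  rw [quadGauss_eq_jacobiSym_mul N hN a ha, quadGauss_one N hN]
  ring

lemma pulsone_apply_add_mul {M N : ℕ} {k d : ℕ} (hk : k < M) (hd : d < N) (k0 l0 : ℕ) :
    pulsone M N k0 l0 ((k + d * M : ℕ) : ZMod (M * N)) =
      if k = k0 then (Real.sqrt N : ℂ)⁻¹ * eFrac N (d * l0) else 0 := by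
  have hM : 0 < M := by omega
  have hlt : k + d * M < M * N := by nlinarith
  rw [pulsone, ZMod.val_cast_of_lt hlt, Nat.add_mul_mod_self_right, Nat.mod_eq_of_lt hk,
    Nat.add_mul_div_right _ _ hM, Nat.div_eq_of_lt hk, zero_add]

/-- **Closed form of the GDAFT of a pulsone (spread carrier / CAZAC form).**
For `N` odd, `M` coprime to `N`, and `A`, `B`, `C` coprime to `M*N`, the GDAFT of the
pulsone localized at `(k0, l0)` equals
`(1/√(MN)) e^{(2πi/(MN))(An² + Bnk0 + Ck0²)} · ε_N · J(CM,N) · e^{-(2πi/N)(4CM)⁻¹_N (Bn + l0 + 2Ck0)²}`,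
where `v` is any multiplicative inverse of `4CM` modulo `N`. -/
theorem gdaft_pulsone_closed_form (M N : ℕ) (hM : 0 < M) (hN : 0 < N) (hNodd : Odd N)
    (hMN : Nat.Coprime M N) (A B C : ℤ)
    (hA : IsCoprime A ((M * N : ℕ) : ℤ)) (hB : IsCoprime B ((M * N : ℕ) : ℤ))
    (hC : IsCoprime C ((M * N : ℕ) : ℤ))
    (k0 l0 : ℕ) (hk0 : k0 < M) (hl0 : l0 < N)
    (v : ℤ) (hv : 4 * C * M * v ≡ 1 [ZMOD (N : ℤ)]) :
    ∀ n : ZMod (M * N),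
      gdaft M N A B C (pulsone M N k0 l0) n =
        (Real.sqrt (M * N) : ℂ)⁻¹ *
          eFrac (M * N) (A * (n.val : ℤ) ^ 2 + B * (n.val : ℤ) * k0 + C * (k0 : ℤ) ^ 2) *
          (if N % 4 = 1 then 1 else Complex.I) *
          (jacobiSym (C * M) N : ℂ) *
          eFrac N (-(v * (B * (n.val : ℤ) + (l0 : ℤ) + 2 * C * k0) ^ 2)) := by
  intro n
  have hN0 : N ≠ 0 := hN.ne'
  have hMN0 : M * N ≠ 0 := mul_ne_zero hM.ne' hN0
  have hsqrt : (Real.sqrt N : ℂ) ≠ 0 := by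
    exact_mod_cast (Real.sqrt_pos.2 (by exact_mod_cast hN : (0 : ℝ) < N)).ne'
  have hCM : IsCoprime (C * M) (N : ℤ) := by
    push_cast at hC
    exact hC.of_mul_right_right.mul_left (Nat.isCoprime_iff_coprime.2 hMN)
  obtain ⟨w, hw⟩ := hv.dvd
  set x : ℤ := (n.val : ℤ) with hx
  set b : ℤ := B * x + l0 + 2 * C * k0 with hb
  have hterm : ∀ d : ℕ,
      eFrac (M * N) (A * x ^ 2 + B * x * ((k0 + d * M : ℕ) : ℤ) + C * ((k0 + d * M : ℕ) : ℤ) ^ 2) *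
        eFrac N (d * l0) =
      eFrac (M * N) (A * x ^ 2 + B * x * k0 + C * (k0 : ℤ) ^ 2) * eFrac N (-(v * b ^ 2)) *
        eFrac N (C * M * (1 * d + 2 * v * b) ^ 2) := by
    intro d
    rw [← eFrac_mul_mul N M hM.ne' (d * l0), ← eFrac_mul_mul N M hM.ne' (-(v * b ^ 2)),
      ← eFrac_mul_mul N M hM.ne' (C * M * (1 * d + 2 * v * b) ^ 2), mul_comm N M,
      ← eFrac_add, ← eFrac_add, ← eFrac_add]
    refine eFrac_congr hMN0 (Int.modEq_iff_dvd.2 ⟨-w * b * (d + v * b), ?_⟩)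
    push_cast
    linear_combination (-(M : ℤ) * b * (d + v * b)) * hw - (M * d : ℤ) * hb
  have hsum : ∑ d ∈ range N, eFrac N (C * M * (1 * d + 2 * v * b) ^ 2) = quadGauss (C * M) N :=
    sum_range_affine hN0 (f := fun t => eFrac N (C * M * t ^ 2))
      (fun s t hst => eFrac_congr hN0 ((hst.pow 2).mul_left _)) isCoprime_one_left _
  rw [gdaft, sum_range_mul_eq_sum_sum, Finset.sum_eq_single k0]
  · have hinner : ∀ d ∈ range N,
        eFrac (M * N) (A * x ^ 2 + B * x * ((k0 + d * M : ℕ) : ℤ) +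
          C * ((k0 + d * M : ℕ) : ℤ) ^ 2) *
          pulsone M N k0 l0 ((k0 + d * M : ℕ) : ZMod (M * N)) =
        (Real.sqrt N : ℂ)⁻¹ * (eFrac (M * N) (A * x ^ 2 + B * x * k0 + C * (k0 : ℤ) ^ 2) *
          eFrac N (-(v * b ^ 2))) * eFrac N (C * M * (1 * d + 2 * v * b) ^ 2) := by
      intro d hd
      rw [pulsone_apply_add_mul hk0 (mem_range.1 hd), if_pos rfl, mul_left_comm, hterm]
      ring
    rw [Finset.sum_congr rfl hinner, ← Finset.mul_sum, hsum, quadGauss_eq N hNodd _ hCM]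
    field_simp
  · intro k hk hkk
    refine Finset.sum_eq_zero fun d hd => ?_
    rw [pulsone_apply_add_mul (mem_range.1 hk) (mem_range.1 hd), if_neg hkk, mul_zero]
  · intro h
    exact absurd (mem_range.2 hk0) h
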